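/- Let A be a commutative (not necessarily unital) algebra over a commutative ring k and let H_A = T(A) = ⊕_{n≥0} A^{⊗n} (with A^{⊗0} = k). Then the quasi-shuffle product * on H_A is a commutative and associative k-bilinear product with unit 1 ∈ k = A^{⊗0}, and it is filtered: the product of a pure tensor in A^{⊗m} and a pure tensor in A^{⊗n} lies in ⊕_{p≤m+n} A^{⊗p}. Hence (H_A, *) is a commutative unitary filtered k-algebra. -/

import Mathlib

open TensorAlgebra

/-- Induction along left multiplication by generators of the tensor algebra. -/
theorem TensorAlgebra.induction_ι_mul {k A : Type*} [CommSemiring k] [AddCommMonoid A]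
    [Module k A] {P : TensorAlgebra k A → Prop}
    (algebraMap : ∀ c : k, P (algebraMap k (TensorAlgebra k A) c))
    (add : ∀ x y, P x → P y → P (x + y))
    (ι_mul : ∀ (a : A) (x : TensorAlgebra k A), P x → P (ι k a * x))
    (x : TensorAlgebra k A) : P x := by
  have key : ∀ y : TensorAlgebra k A, (∀ c : k, P (c • y)) → ∀ c : k, P (c • (x * y)) := by
    induction x using TensorAlgebra.induction with
    | algebraMap r =>
      intro y hy c
      rw [← Algebra.smul_def, smul_smul]
      exact hy _
    | ι a =>
      intro y hy c
      rw [← mul_smul_comm]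
      exact ι_mul a _ (hy c)
    | mul x₁ x₂ h₁ h₂ =>
      intro y hy c
      rw [mul_assoc]
      exact h₁ _ (h₂ y hy) c
    | add x₁ x₂ h₁ h₂ =>
      intro y hy c
      rw [add_mul, smul_add]
      exact add _ _ (h₁ y hy c) (h₂ y hy c)
  simpa using key 1 (fun c => by simpa [Algebra.smul_def] using algebraMap c) 1

/-- The part `⊕_{p ≤ n} A^{⊗p}` of the tensor algebra. -/
abbrev TensorAlgebra.degreeLE (k A : Type*) [CommSemiring k] [AddCommMonoid A] [Module k A]
    (n : ℕ) : Submodule k (TensorAlgebra k A) :=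
  ⨆ (p : ℕ) (_ : p ≤ n), (LinearMap.range (ι k : A →ₗ[k] TensorAlgebra k A)) ^ p

theorem TensorAlgebra.pow_le_degreeLE (k A : Type*) [CommSemiring k] [AddCommMonoid A]
    [Module k A] {p n : ℕ} (h : p ≤ n) :
    (LinearMap.range (ι k : A →ₗ[k] TensorAlgebra k A)) ^ p ≤ degreeLE k A n :=
  le_iSup₂_of_le p h le_rfl

theorem TensorAlgebra.degreeLE_mono (k A : Type*) [CommSemiring k] [AddCommMonoid A]
    [Module k A] : Monotone (degreeLE k A) :=
  fun _ _ h => iSup₂_le fun _ hp => pow_le_degreeLE k A (hp.trans h)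

theorem TensorAlgebra.ι_mul_mem_degreeLE {k A : Type*} [CommSemiring k] [AddCommMonoid A]
    [Module k A] (a : A) {n : ℕ} {x : TensorAlgebra k A} (hx : x ∈ degreeLE k A n) :
    ι k a * x ∈ degreeLE k A (n + 1) := by
  have h : degreeLE k A n ≤ (degreeLE k A (n + 1)).comap (LinearMap.mulLeft k (ι k a)) := by
    refine iSup₂_le fun p hp y hy => pow_le_degreeLE k A (Nat.succ_le_succ hp) ?_
    rw [pow_succ']
    exact Submodule.mul_mem_mul (LinearMap.mem_range_self _ a) hy
  exact h hx

/-- Let `A` be a commutative (not necessarily unital) algebra over a commutative ring `k`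
and identify `H_A = T(A) = ⊕_{n≥0} A^{⊗n}` with the tensor algebra of the `k`-module `A`,
where the pure tensor `a₁⊗⋯⊗a_n` corresponds to `ι a₁ * ⋯ * ι a_n` (concatenation
product).  The quasi-shuffle product `*` is the `k`-bilinear map `q` characterized by:
elements of `k = A^{⊗0}` multiply by scalar action on both sides, and
`(a⊗𝔞) * (b⊗𝔟) = a⊗(𝔞 * (b⊗𝔟)) + b⊗((a⊗𝔞) * 𝔟) + (ab)⊗(𝔞 * 𝔟)`.
Then `q` is commutative, associative, has unit `1 ∈ k = A^{⊗0}`, and is filtered: the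
quasi-shuffle product of a pure tensor of degree `m` with one of degree `n` lies in
`⊕_{p ≤ m+n} A^{⊗p}`.  Hence `(H_A, *)` is a commutative unitary filtered `k`-algebra. -/
theorem quasiShuffle_comm_assoc_unital_filtered
    {k A : Type*} [CommRing k] [NonUnitalCommRing A] [Module k A]
    [SMulCommClass k A A] [IsScalarTower k A A]
    (q : TensorAlgebra k A →ₗ[k] TensorAlgebra k A →ₗ[k] TensorAlgebra k A)
    -- elements of k = A^{⊗0} multiply by scalar action on both sides
    (hq_scalar_left : ∀ (c : k) (x : TensorAlgebra k A),
      q (algebraMap k (TensorAlgebra k A) c) x = c • x)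
    (hq_scalar_right : ∀ (c : k) (x : TensorAlgebra k A),
      q x (algebraMap k (TensorAlgebra k A) c) = c • x)
    -- the quasi-shuffle recursion (a⊗𝔞)*(b⊗𝔟) = a⊗(𝔞*(b⊗𝔟)) + b⊗((a⊗𝔞)*𝔟) + (ab)⊗(𝔞*𝔟)
    (hq_rec : ∀ (a b : A) (x y : TensorAlgebra k A),
      q (ι k a * x) (ι k b * y) =
        ι k a * q x (ι k b * y) + ι k b * q (ι k a * x) y + ι k (a * b) * q x y) :
    -- commutativity
    (∀ x y : TensorAlgebra k A, q x y = q y x) ∧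
    -- associativity
    (∀ x y z : TensorAlgebra k A, q (q x y) z = q x (q y z)) ∧
    -- 1 ∈ k = A^{⊗0} is a unit
    (∀ x : TensorAlgebra k A, q 1 x = x) ∧
    (∀ x : TensorAlgebra k A, q x 1 = x) ∧
    -- filtered: the product of pure tensors of degrees m and n lies in ⊕_{p ≤ m+n} A^{⊗p}
    (∀ m n : ℕ,
      ∀ x ∈ (LinearMap.range (ι k : A →ₗ[k] TensorAlgebra k A)) ^ m,
      ∀ y ∈ (LinearMap.range (ι k : A →ₗ[k] TensorAlgebra k A)) ^ n,
        q x y ∈ ⨆ (p : ℕ) (_ : p ≤ m + n),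
          (LinearMap.range (ι k : A →ₗ[k] TensorAlgebra k A)) ^ p) := by
  have hq_one_left (x : TensorAlgebra k A) : q 1 x = x := by
    simpa using hq_scalar_left 1 x
  have hq_one_right (x : TensorAlgebra k A) : q x 1 = x := by
    simpa using hq_scalar_right 1 x
  refine ⟨fun x => ?_, fun x => ?_, hq_one_left, hq_one_right, fun m => ?_⟩
  · induction x using TensorAlgebra.induction_ι_mul with
    | algebraMap c => intro y; rw [hq_scalar_left, hq_scalar_right]
    | add x₁ x₂ h₁ h₂ => intro y; simp [h₁, h₂]
    | ι_mul a x hx =>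
      intro y
      induction y using TensorAlgebra.induction_ι_mul with
      | algebraMap c => rw [hq_scalar_left, hq_scalar_right]
      | add y₁ y₂ h₁ h₂ => simp [h₁, h₂]
      | ι_mul b y hy =>
        rw [hq_rec, hq_rec, hx, hx, hy, mul_comm a b]
        abel
  · induction x using TensorAlgebra.induction_ι_mul with
    | algebraMap c => intro y z; simp [hq_scalar_left]
    | add x₁ x₂ h₁ h₂ => intro y z; simp [h₁, h₂]
    | ι_mul a x hx =>
      intro y
      induction y using TensorAlgebra.induction_ι_mul with
      | algebraMap c => intro z; simp [hq_scalar_left, hq_scalar_right]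
      | add y₁ y₂ h₁ h₂ => intro z; simp [h₁, h₂]
      | ι_mul b y hy =>
        intro z
        induction z using TensorAlgebra.induction_ι_mul with
        | algebraMap c => simp [hq_scalar_right]
        | add z₁ z₂ h₁ h₂ => simp [h₁, h₂]
        | ι_mul c z hz =>
          rw [hq_rec a b, map_add, map_add, LinearMap.add_apply, LinearMap.add_apply] at hz
          rw [hq_rec a b, hq_rec b c]
          simp only [map_add, LinearMap.add_apply]
          rw [hq_rec a c, hq_rec b c, hq_rec (a * b) c, hq_rec a b, hq_rec a c,
            hq_rec a (b * c), ← hz, hx, hx, hx, hx, hy, hy, hq_rec b c, mul_assoc a b c]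
          simp only [map_add, mul_add]
          abel
  · induction m with
    | zero =>
      intro n x hx y hy
      obtain ⟨c, rfl⟩ := Submodule.mem_one.mp (by simpa using hx)
      rw [hq_scalar_left]
      exact Submodule.smul_mem _ c (TensorAlgebra.pow_le_degreeLE k A (by omega) hy)
    | succ m ihm =>
      intro n
      induction n with
      | zero =>
        intro x hx y hy
        obtain ⟨c, rfl⟩ := Submodule.mem_one.mp (by simpa using hy)
        rw [hq_scalar_right]
        exact Submodule.smul_mem _ c (TensorAlgebra.pow_le_degreeLE k A (by omega) hx)
      | succ n ihn =>
        intro x hx y hy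
        rw [pow_succ'] at hx hy
        refine Submodule.mul_induction_on hx ?_ fun x₁ x₂ h₁ h₂ => by
          rw [map_add, LinearMap.add_apply]
          exact add_mem h₁ h₂
        rintro _ ⟨a, rfl⟩ x hx
        refine Submodule.mul_induction_on hy ?_ fun y₁ y₂ h₁ h₂ => by
          rw [map_add]
          exact add_mem h₁ h₂
        rintro _ ⟨b, rfl⟩ y hy
        have hax : ι k a * x ∈ (LinearMap.range (ι k : A →ₗ[k] TensorAlgebra k A)) ^ (m + 1) := by
          rw [pow_succ']
          exact Submodule.mul_mem_mul (LinearMap.mem_range_self _ a) hx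
        have hby : ι k b * y ∈ (LinearMap.range (ι k : A →ₗ[k] TensorAlgebra k A)) ^ (n + 1) := by
          rw [pow_succ']
          exact Submodule.mul_mem_mul (LinearMap.mem_range_self _ b) hy
        rw [hq_rec]
        refine add_mem (add_mem ?_ ?_) ?_
        · exact TensorAlgebra.degreeLE_mono k A (by omega)
            (TensorAlgebra.ι_mul_mem_degreeLE a (ihm (n + 1) x hx _ hby))
        · exact TensorAlgebra.degreeLE_mono k A (by omega)
            (TensorAlgebra.ι_mul_mem_degreeLE b (ihn _ hax y hy))
        · exact TensorAlgebra.degreeLE_mono k A (by omega)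
            (TensorAlgebra.ι_mul_mem_degreeLE (a * b) (ihm n x hx y hy))
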